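/- Let F_1, …, F_M : ℝ^d → ℝ be differentiable, each with L-Lipschitz gradient (L > 0), and let f = (1/M)·∑_{i=1}^M F_i. Assume there exist H ≥ 0, B ≥ 1, G ≥ 0 such that for all θ ∈ ℝ^d, (1/M)·∑_{i=1}^M ‖∇F_i(θ)‖² ≤ H² + B²·‖∇f(θ)‖² and ‖∇f(θ)‖ ≤ G. Let η > 0 and let T be a positive integer with η·L·T ≤ 1/6. On a probability space, let ξ^i_t (i ∈ [M], 0 ≤ t < T) be random vectors in ℝ^d with E[‖ξ^i_t‖²] ≤ σ² for some σ ≥ 0. Fix θ̄ ∈ ℝ^d and define, for each i, the random client trajectory θ^i_0 = θ̄, θ^i_{t+1} = θ^i_t − η·(∇F_i(θ^i_t) + ξ^i_t), and the deterministic reference trajectory θ*_0 = θ̄, θ*_{t+1} = θ*_t − η·∇f(θ*_t). Then E[ ‖(1/M)·∑_{i=1}^M θ^i_T − θ*_T‖ ] ≤ 2·η·T·( √(H² + (B² − 1)·G²) + σ ). -/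

import Mathlib

open MeasureTheory

/-- The mean distance to the mean is at most the standard deviation. -/
theorem mean_norm_sub_mean_le_sqrt {E : Type*} [NormedAddCommGroup E] [InnerProductSpace ℝ E]
    {M : ℕ} (hM : 0 < M) (v : Fin M → E) (m : E) (hm : m = (M : ℝ)⁻¹ • ∑ i, v i) :
    (M : ℝ)⁻¹ * ∑ i, ‖v i - m‖ ≤ √((M : ℝ)⁻¹ * ∑ i, ‖v i‖ ^ 2 - ‖m‖ ^ 2) := by
  have hM' : (M : ℝ) ≠ 0 := by positivity
  have hsum : ∑ i, v i = (M : ℝ) • m := by rw [hm, smul_inv_smul₀ hM']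
  have hinner : ∑ i, inner ℝ (v i) m = M * ‖m‖ ^ 2 := by
    rw [← sum_inner, hsum, real_inner_smul_left, real_inner_self_eq_norm_sq]
  have hvar : (M : ℝ)⁻¹ * ∑ i, ‖v i‖ ^ 2 - ‖m‖ ^ 2 = (M : ℝ)⁻¹ * ∑ i, ‖v i - m‖ ^ 2 := by
    simp only [norm_sub_sq_real, Finset.sum_add_distrib, Finset.sum_sub_distrib,
      ← Finset.mul_sum, hinner, Finset.sum_const, Finset.card_univ, Fintype.card_fin,
      nsmul_eq_mul]
    field_simp
    ring
  have hcs := sq_sum_le_card_mul_sum_sq (s := Finset.univ) (f := fun i => ‖v i - m‖)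
  rw [Finset.card_univ, Fintype.card_fin] at hcs
  rw [hvar]
  apply Real.le_sqrt_of_sq_le
  calc ((M : ℝ)⁻¹ * ∑ i, ‖v i - m‖) ^ 2
      = (M : ℝ)⁻¹ ^ 2 * (∑ i, ‖v i - m‖) ^ 2 := by ring
    _ ≤ (M : ℝ)⁻¹ ^ 2 * (M * ∑ i, ‖v i - m‖ ^ 2) := by gcongr
    _ = (M : ℝ)⁻¹ * ∑ i, ‖v i - m‖ ^ 2 := by field_simp

/-- The gradient of an average is the average of the gradients. -/
theorem gradient_mean {E : Type*} [NormedAddCommGroup E] [InnerProductSpace ℝ E]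
    [CompleteSpace E] {M : ℕ} {F : Fin M → E → ℝ} (hF : ∀ i, Differentiable ℝ (F i)) (x : E) :
    gradient (fun z => (M : ℝ)⁻¹ * ∑ j, F j z) x
      = (M : ℝ)⁻¹ • ∑ j, gradient (F j) x := by
  apply HasGradientAt.gradient
  rw [hasGradientAt_iff_hasFDerivAt, map_smul, map_sum]
  exact (HasFDerivAt.fun_sum fun j _ => (hF j x).hasGradientAt.hasFDerivAt).const_mul _

/-- On a probability space, a second-moment bound yields integrability and a first-moment bound. -/
theorem integrable_norm_and_integral_norm_le {Ω E : Type*} [MeasurableSpace Ω]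
    [NormedAddCommGroup E] {P : Measure Ω} [IsProbabilityMeasure P] {X : Ω → E}
    (hX : AEStronglyMeasurable X P) (hint : Integrable (fun ω => ‖X ω‖ ^ 2) P)
    {σ : ℝ} (hσ : 0 ≤ σ) (hsq : ∫ ω, ‖X ω‖ ^ 2 ∂P ≤ σ ^ 2) :
    Integrable (fun ω => ‖X ω‖) P ∧ ∫ ω, ‖X ω‖ ∂P ≤ σ := by
  have hX1 : Integrable (fun ω => ‖X ω‖) P :=
    (((memLp_two_iff_integrable_sq_norm hX).2 hint).integrable one_le_two).norm
  refine ⟨hX1, abs_le_of_sq_le_sq' ?_ hσ |>.2⟩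
  set m := ∫ ω, ‖X ω‖ ∂P with hm
  have hnonneg : 0 ≤ ∫ ω, (‖X ω‖ - m) ^ 2 ∂P := integral_nonneg fun ω => sq_nonneg _
  have hexp : ∫ ω, (‖X ω‖ - m) ^ 2 ∂P = ∫ ω, ‖X ω‖ ^ 2 ∂P - m ^ 2 := by
    have hrw : (fun ω => (‖X ω‖ - m) ^ 2)
        = fun ω => ‖X ω‖ ^ 2 - (2 * m * ‖X ω‖ - m ^ 2) := by
      funext ω; ring
    have hlin : Integrable (fun ω => 2 * m * ‖X ω‖ - m ^ 2) P :=
      (hX1.const_mul _).sub (integrable_const _)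
    rw [hrw, integral_sub hint hlin, integral_sub (hX1.const_mul _) (integrable_const _),
      integral_const_mul, ← hm, integral_const, probReal_univ, one_smul]
    ring
  linarith

/-- Discrete Grönwall bound over a horizon on which the accumulated growth rate is small. -/
theorem le_two_mul_sum_of_le_one_add_mul_add {a c : ℕ → ℝ} {x : ℝ} {T : ℕ} (hx : 0 ≤ x)
    (hxT : 2 * (x * T) ≤ 1) (hc : ∀ t, 0 ≤ c t) (ha : a 0 ≤ 0)
    (hrec : ∀ t, a (t + 1) ≤ (1 + x) * a t + c t) :
    a T ≤ 2 * ∑ t ∈ Finset.range T, c t := by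
  have hsum : ∀ t, 0 ≤ ∑ s ∈ Finset.range t, c s := fun t => Finset.sum_nonneg fun s _ => hc s
  have key : ∀ t ≤ T, a t ≤ (1 + 2 * (x * t)) * ∑ s ∈ Finset.range t, c s := by
    intro t
    induction t with
    | zero => simpa using ha
    | succ t ih =>
      intro ht
      have hle : x * t ≤ x * T := by gcongr; omega
      have hxt : 0 ≤ x * t := by positivity
      have hcoef : (1 + x) * (1 + 2 * (x * t)) ≤ 1 + 2 * (x * (t + 1)) := by nlinarith
      rw [Finset.sum_range_succ]
      push_cast
      calc a (t + 1) ≤ (1 + x) * a t + c t := hrec t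
        _ ≤ (1 + x) * ((1 + 2 * (x * t)) * ∑ s ∈ Finset.range t, c s) + c t := by
            gcongr; exact ih (by omega)
        _ = (1 + x) * (1 + 2 * (x * t)) * (∑ s ∈ Finset.range t, c s) + 1 * c t := by ring
        _ ≤ (1 + 2 * (x * (t + 1))) * (∑ s ∈ Finset.range t, c s)
              + (1 + 2 * (x * (t + 1))) * c t := by
            gcongr
            · exact hsum t
            · exact hc t
            · nlinarith
        _ = _ := by ring
  exact (key T le_rfl).trans (mul_le_mul_of_nonneg_right (by linarith) (hsum T))

/-- In-expectation deviation of the federated local-SGD aggregate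
from the centralized gradient-descent reference under bounded heterogeneity. -/
theorem fed_sgd_expected_deviation {d : ℕ} (M : ℕ) (hM : 0 < M)
    (L H B G η σ : ℝ)
    (hL : 0 < L) (hH : 0 ≤ H) (hB : 1 ≤ B) (hG : 0 ≤ G) (hη : 0 < η) (hσ : 0 ≤ σ)
    (T : ℕ) (hT : 0 < T) (hstep : η * L * T ≤ 1 / 6)
    (F : Fin M → EuclideanSpace ℝ (Fin d) → ℝ)
    (hdiff : ∀ i, Differentiable ℝ (F i))
    (hlip : ∀ i x y, ‖gradient (F i) x - gradient (F i) y‖ ≤ L * ‖x - y‖)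
    (hhet : ∀ θ, (M : ℝ)⁻¹ * ∑ i, ‖gradient (F i) θ‖ ^ 2
      ≤ H ^ 2 + B ^ 2 * ‖gradient (fun z => (M : ℝ)⁻¹ * ∑ j, F j z) θ‖ ^ 2)
    (hGbound : ∀ θ, ‖gradient (fun z => (M : ℝ)⁻¹ * ∑ j, F j z) θ‖ ≤ G)
    {Ω : Type*} [MeasurableSpace Ω] (P : Measure Ω) [IsProbabilityMeasure P]
    (ξ : Fin M → ℕ → Ω → EuclideanSpace ℝ (Fin d))
    (hmeas : ∀ i t, Measurable (ξ i t))
    (hint : ∀ i t, t < T → Integrable (fun ω => ‖ξ i t ω‖ ^ 2) P)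
    (hnoise : ∀ i t, t < T → ∫ ω, ‖ξ i t ω‖ ^ 2 ∂P ≤ σ ^ 2)
    (θbar : EuclideanSpace ℝ (Fin d))
    (θ : Fin M → ℕ → Ω → EuclideanSpace ℝ (Fin d))
    (θs : ℕ → EuclideanSpace ℝ (Fin d))
    (hθ0 : ∀ i ω, θ i 0 ω = θbar)
    (hθrec : ∀ i t ω, θ i (t + 1) ω
      = θ i t ω - η • (gradient (F i) (θ i t ω) + ξ i t ω))
    (hθs0 : θs 0 = θbar)
    (hθsrec : ∀ t, θs (t + 1)
      = θs t - η • gradient (fun z => (M : ℝ)⁻¹ * ∑ j, F j z) (θs t)) :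
    ∫ ω, ‖(M : ℝ)⁻¹ • ∑ i, θ i T ω - θs T‖ ∂P
      ≤ 2 * η * T * (Real.sqrt (H ^ 2 + (B ^ 2 - 1) * G ^ 2) + σ) := by
  set f : EuclideanSpace ℝ (Fin d) → ℝ := fun z => (M : ℝ)⁻¹ * ∑ j, F j z
  set S : ℝ := √(H ^ 2 + (B ^ 2 - 1) * G ^ 2)
  have hM' : (M : ℝ) ≠ 0 := by positivity
  have hhetS : ∀ x, (M : ℝ)⁻¹ * ∑ i, ‖gradient (F i) x - gradient f x‖ ≤ S := by
    intro x
    refine (mean_norm_sub_mean_le_sqrt hM _ _ (gradient_mean hdiff x)).trans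
      (Real.sqrt_le_sqrt ?_)
    have hGsq : (B ^ 2 - 1) * ‖gradient f x‖ ^ 2 ≤ (B ^ 2 - 1) * G ^ 2 :=
      mul_le_mul_of_nonneg_left (pow_le_pow_left₀ (norm_nonneg _) (hGbound x) 2) (by nlinarith)
    linarith [hhet x]
  have hstepNorm : ∀ i t ω, ‖θ i (t + 1) ω - θs (t + 1)‖ ≤ (1 + η * L) * ‖θ i t ω - θs t‖
      + η * (‖gradient (F i) (θs t) - gradient f (θs t)‖ + ‖ξ i t ω‖) := by
    intro i t ω
    have hdecomp : θ i (t + 1) ω - θs (t + 1) = (θ i t ω - θs t)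
        - η • ((gradient (F i) (θ i t ω) - gradient (F i) (θs t))
          + (gradient (F i) (θs t) - gradient f (θs t)) + ξ i t ω) := by
      rw [hθrec, hθsrec]
      module
    rw [hdecomp]
    calc _ ≤ ‖θ i t ω - θs t‖ + ‖η • ((gradient (F i) (θ i t ω) - gradient (F i) (θs t))
          + (gradient (F i) (θs t) - gradient f (θs t)) + ξ i t ω)‖ := norm_sub_le _ _
      _ ≤ ‖θ i t ω - θs t‖ + η * (L * ‖θ i t ω - θs t‖
          + ‖gradient (F i) (θs t) - gradient f (θs t)‖ + ‖ξ i t ω‖) := by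
        rw [norm_smul, Real.norm_of_nonneg hη.le]
        gcongr
        refine norm_add₃_le.trans ?_
        gcongr
        exact hlip i _ _
      _ = _ := by ring
  have hpath : ∀ ω, ‖(M : ℝ)⁻¹ • ∑ i, θ i T ω - θs T‖
      ≤ 2 * ∑ t ∈ Finset.range T, η * (S + (M : ℝ)⁻¹ * ∑ i, ‖ξ i t ω‖) := by
    intro ω
    have hmean : (M : ℝ)⁻¹ • ∑ i, θ i T ω - θs T = (M : ℝ)⁻¹ • ∑ i, (θ i T ω - θs T) := by
      rw [Finset.sum_sub_distrib, Finset.sum_const, Finset.card_univ, Fintype.card_fin, smul_sub,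
        ← Nat.cast_smul_eq_nsmul ℝ, inv_smul_smul₀ hM']
    calc _ ≤ (M : ℝ)⁻¹ * ∑ i, ‖θ i T ω - θs T‖ := by
          rw [hmean, norm_smul, Real.norm_of_nonneg (by positivity)]
          gcongr
          exact norm_sum_le _ _
      _ ≤ _ := by
          refine le_two_mul_sum_of_le_one_add_mul_add
            (a := fun t => (M : ℝ)⁻¹ * ∑ i, ‖θ i t ω - θs t‖) (x := η * L)
            (by positivity) (by linarith) (fun t => by positivity) (by simp [hθ0, hθs0]) ?_
          intro t
          calc (M : ℝ)⁻¹ * ∑ i, ‖θ i (t + 1) ω - θs (t + 1)‖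
              ≤ (M : ℝ)⁻¹ * ∑ i, ((1 + η * L) * ‖θ i t ω - θs t‖
                + η * (‖gradient (F i) (θs t) - gradient f (θs t)‖ + ‖ξ i t ω‖)) := by
                gcongr with i
                exact hstepNorm i t ω
            _ = (1 + η * L) * ((M : ℝ)⁻¹ * ∑ i, ‖θ i t ω - θs t‖)
                + η * ((M : ℝ)⁻¹ * ∑ i, ‖gradient (F i) (θs t) - gradient f (θs t)‖
                  + (M : ℝ)⁻¹ * ∑ i, ‖ξ i t ω‖) := by
                simp only [Finset.sum_add_distrib, ← Finset.mul_sum]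
                ring
            _ ≤ _ := by
                gcongr
                exact hhetS _
  have hmoment : ∀ i t, t < T → Integrable (fun ω => ‖ξ i t ω‖) P ∧ ∫ ω, ‖ξ i t ω‖ ∂P ≤ σ :=
    fun i t ht => integrable_norm_and_integral_norm_le (hmeas i t).aestronglyMeasurable
      (hint i t ht) hσ (hnoise i t ht)
  have hmeanInt : ∀ t < T, Integrable (fun ω => (M : ℝ)⁻¹ * ∑ i, ‖ξ i t ω‖) P := fun t ht =>
    (integrable_finsetSum _ fun i _ => (hmoment i t ht).1).const_mul _
  have htermInt : ∀ t ∈ Finset.range T,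
      Integrable (fun ω => η * (S + (M : ℝ)⁻¹ * ∑ i, ‖ξ i t ω‖)) P := fun t ht =>
    ((integrable_const S).add (hmeanInt t (Finset.mem_range.1 ht))).const_mul η
  have htermLe : ∀ t ∈ Finset.range T,
      ∫ ω, η * (S + (M : ℝ)⁻¹ * ∑ i, ‖ξ i t ω‖) ∂P ≤ η * (S + σ) := by
    intro t ht
    have ht' := Finset.mem_range.1 ht
    rw [integral_const_mul, integral_add (integrable_const S) (hmeanInt t ht'),
      integral_const_mul, integral_finsetSum _ fun i _ => (hmoment i t ht').1]
    simp only [integral_const, probReal_univ, one_smul]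
    gcongr
    calc (M : ℝ)⁻¹ * ∑ i, ∫ ω, ‖ξ i t ω‖ ∂P ≤ (M : ℝ)⁻¹ * ∑ _i : Fin M, σ := by
          gcongr with i
          exact (hmoment i t ht').2
      _ = σ := by simp [hM']
  calc ∫ ω, ‖(M : ℝ)⁻¹ • ∑ i, θ i T ω - θs T‖ ∂P
      ≤ ∫ ω, 2 * ∑ t ∈ Finset.range T, η * (S + (M : ℝ)⁻¹ * ∑ i, ‖ξ i t ω‖) ∂P :=
        integral_mono_of_nonneg (.of_forall fun _ => norm_nonneg _)
          ((integrable_finsetSum _ htermInt).const_mul 2) (.of_forall hpath)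
    _ = 2 * ∑ t ∈ Finset.range T, ∫ ω, η * (S + (M : ℝ)⁻¹ * ∑ i, ‖ξ i t ω‖) ∂P := by
        rw [integral_const_mul, integral_finsetSum _ htermInt]
    _ ≤ 2 * ∑ _t ∈ Finset.range T, η * (S + σ) := by
        gcongr with t ht
        exact htermLe t ht
    _ = 2 * η * T * (S + σ) := by
        rw [Finset.sum_const, Finset.card_range, nsmul_eq_mul]
        ring
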